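/- arXiv:1712.00314 — 2 statements merged into one kernel-verified Lean document; each statement's English description precedes it below -/
import Mathlib

section
/- The subcategory 𝒢(𝒞)^{⊥1} is injectively coresolving in 𝒜: it contains all injective objects of 𝒜, it is closed under extensions, and for every short exact sequence 0→L→M→N→0 in 𝒜 with L,M∈𝒢(𝒞)^{⊥1} one has N∈𝒢(𝒞)^{⊥1}. -/
open CategoryTheory CategoryTheory.Limits CategoryTheory.Abelian ZeroObject

universe w t v u

variable {A : Type u} [Category.{v} A] [Abelian A]

/-- `f`, `g` form a short exact sequence `0 ⟶ X ⟶ Y ⟶ Z ⟶ 0` in `A`. -/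
def IsSES {X Y Z : A} (f : X ⟶ Y) (g : Y ⟶ Z) : Prop :=
  ∃ hw : f ≫ g = 0, (ShortComplex.mk f g hw).ShortExact

/-- The short exact sequence `0 ⟶ X ⟶ Y ⟶ Z ⟶ 0` remains exact after applying
`Hom_A(C, -)` for every `C` in `𝒞`. -/
def HomLeftExact (𝒞 : A → Prop) {X Y Z : A} (f : X ⟶ Y) (g : Y ⟶ Z) : Prop :=
  ∀ ⦃C : A⦄, 𝒞 C →
    Function.Injective (fun h : C ⟶ X => h ≫ f) ∧
    Function.Exact (fun h : C ⟶ X => h ≫ f) (fun h : C ⟶ Y => h ≫ g) ∧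
    Function.Surjective (fun h : C ⟶ Y => h ≫ g)

/-- The short exact sequence `0 ⟶ X ⟶ Y ⟶ Z ⟶ 0` remains exact after applying
`Hom_A(-, C)` for every `C` in `𝒞`. -/
def HomRightExact (𝒞 : A → Prop) {X Y Z : A} (f : X ⟶ Y) (g : Y ⟶ Z) : Prop :=
  ∀ ⦃C : A⦄, 𝒞 C →
    Function.Injective (fun h : Z ⟶ C => g ≫ h) ∧
    Function.Exact (fun h : Z ⟶ C => g ≫ h) (fun h : Y ⟶ C => f ≫ h) ∧
    Function.Surjective (fun h : Y ⟶ C => f ≫ h)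

/-- `M` belongs to the Gorenstein subcategory `𝒢(𝒞)`: there is an exact sequence
`⋯ ⟶ C_1 ⟶ C_0 ⟶ C^0 ⟶ C^1 ⟶ ⋯` with all terms in `𝒞`, which remains exact after
applying `Hom_A(C,-)` and `Hom_A(-,C)` for every `C ∈ 𝒞`, such that
`M ≅ Im(C_0 ⟶ C^0)`. -/
def IsGorenstein (𝒞 : A → Prop) (M : A) : Prop :=
  ∃ (X : ℤ → A) (d : ∀ n : ℤ, X n ⟶ X (n + 1)) (hw : ∀ n, d n ≫ d (n + 1) = 0),
    (∀ n, 𝒞 (X n)) ∧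
    (∀ n, (ShortComplex.mk (d n) (d (n + 1)) (hw n)).Exact) ∧
    (∀ (n : ℤ) ⦃C : A⦄, 𝒞 C →
      Function.Exact (fun h : C ⟶ X n => h ≫ d n) (fun h : C ⟶ X (n + 1) => h ≫ d (n + 1))) ∧
    (∀ (n : ℤ) ⦃C : A⦄, 𝒞 C →
      Function.Exact (fun h : X (n + 1 + 1) ⟶ C => d (n + 1) ≫ h)
        (fun h : X (n + 1) ⟶ C => d n ≫ h)) ∧
    Nonempty (M ≅ Limits.image (d 0))

/-- `𝒞` is a full additive subcategory closed under isomorphisms, encoded as a predicate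
closed under isomorphisms, containing a zero object and closed under binary biproducts. -/
def IsAdditiveClosed (𝒞 : A → Prop) : Prop :=
  (∀ ⦃X Y : A⦄, (X ≅ Y) → 𝒞 X → 𝒞 Y) ∧ 𝒞 (0 : A) ∧ ∀ ⦃X Y : A⦄, 𝒞 X → 𝒞 Y → 𝒞 (X ⊞ Y)

/-- `𝒫(A)` is a generator for `𝒞`: for every `C ∈ 𝒞` there is a short exact sequence
`0 ⟶ C' ⟶ P ⟶ C ⟶ 0` with `P` projective and `C' ∈ 𝒞`. -/
def ProjIsGeneratorFor (𝒞 : A → Prop) : Prop :=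
  ∀ ⦃C : A⦄, 𝒞 C → ∃ (C' P : A) (f : C' ⟶ P) (g : P ⟶ C),
    Projective P ∧ 𝒞 C' ∧ IsSES f g

section Ext

variable [HasExt.{w} A]

/-- `𝒞` is self-orthogonal: `Ext^i(C, C') = 0` for all `i ≥ 1` and `C, C' ∈ 𝒞`. -/
def SelfOrthogonal (𝒞 : A → Prop) : Prop :=
  ∀ ⦃C C' : A⦄, 𝒞 C → 𝒞 C' → ∀ i : ℕ, 1 ≤ i → Subsingleton (Abelian.Ext C C' i)

/-- `M ∈ 𝒢(𝒞)^{⊥1}`, i.e. `Ext^1(G, M) = 0` for every `G ∈ 𝒢(𝒞)`. -/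
def RightPerp1 (𝒞 : A → Prop) (M : A) : Prop :=
  ∀ ⦃G : A⦄, IsGorenstein 𝒞 G → Subsingleton (Abelian.Ext G M 1)

/-- `f : G ⟶ M` is a special `𝒢(𝒞)`-precover of `M`. -/
def IsSpecialPrecover (𝒞 : A → Prop) {G M : A} (f : G ⟶ M) : Prop :=
  IsGorenstein 𝒞 G ∧ Epi f ∧ RightPerp1 𝒞 (kernel f) ∧
    ∀ ⦃G' : A⦄, IsGorenstein 𝒞 G' → Function.Surjective (fun h : G' ⟶ G => h ≫ f)

/-- `M` belongs to the special precovered category `spc(𝒢(𝒞))`. -/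
def HasSpecialPrecover (𝒞 : A → Prop) (M : A) : Prop :=
  ∃ (G : A) (f : G ⟶ M), IsSpecialPrecover 𝒞 f

/-- `𝒞` is a generator for `𝒢(𝒞)^{⊥1}`. -/
def GeneratorForPerp (𝒞 : A → Prop) : Prop :=
  ∀ ⦃T : A⦄, RightPerp1 𝒞 T → ∃ (T' C : A) (f : T' ⟶ C) (g : C ⟶ T),
    𝒞 C ∧ RightPerp1 𝒞 T' ∧ IsSES f g

end Ext

/-- An exact pair `f`, `g` yields the short exact sequence `0 ⟶ im f ⟶ Y ⟶ im g ⟶ 0`,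
up to an isomorphism `M ≅ im g`. -/
lemma isSES_image_of_exact {X Y Z M : A} (f : X ⟶ Y) (g : Y ⟶ Z) (hw : f ≫ g = 0)
    (h : (ShortComplex.mk f g hw).Exact) (e : M ≅ Limits.image g) :
    IsSES (Limits.image.ι f) (Limits.factorThruImage g ≫ e.inv) := by
  have hz : Limits.image.ι f ≫ Limits.factorThruImage g ≫ e.inv = 0 := by
    rw [← cancel_epi (Limits.factorThruImage f), ← cancel_mono (e.hom ≫ Limits.image.ι g)]
    simp [hw]
  refine ⟨hz, ShortComplex.ShortExact.mk' ?_ (by dsimp; infer_instance)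
    (by dsimp; infer_instance)⟩
  rw [ShortComplex.exact_iff_exact_up_to_refinements] at h ⊢
  intro T x hx
  dsimp at x hx
  have hx' : x ≫ g = 0 := by
    have := hx =≫ (e.hom ≫ Limits.image.ι g)
    simpa using this
  obtain ⟨T', π, hπ, y, hy⟩ := h x hx'
  exact ⟨T', π, hπ, y ≫ Limits.factorThruImage f, by simpa using hy⟩

/-- Every object of `𝒞` is Gorenstein: it is the image of the square-zero endomorphism
`snd ≫ inl` of `C ⊞ C`. -/
lemma isGorenstein_of_mem {𝒞 : A → Prop} (hadd : IsAdditiveClosed 𝒞) {C : A} (hC : 𝒞 C) :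
    IsGorenstein 𝒞 C := by
  refine ⟨fun _ => C ⊞ C, fun _ => biprod.snd ≫ biprod.inl, fun _ => by simp,
    fun _ => hadd.2.2 hC hC, fun _ => ?_, fun _ D _ h => ⟨fun hh => ?_, ?_⟩,
    fun _ D _ h => ⟨fun hh => ?_, ?_⟩,
    ⟨Limits.image.isoStrongEpiMono biprod.snd biprod.inl rfl⟩⟩
  · rw [ShortComplex.exact_iff_exact_up_to_refinements]
    intro T x hx
    dsimp at x hx
    have hx' : x ≫ biprod.snd = 0 := by simpa using hx =≫ biprod.fst
    refine ⟨T, 𝟙 T, inferInstance, x ≫ biprod.fst ≫ biprod.inr, ?_⟩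
    ext <;> simp [hx']
  · dsimp at h hh
    have h' : h ≫ biprod.snd = 0 := by simpa using hh =≫ biprod.fst
    refine ⟨h ≫ biprod.fst ≫ biprod.inr, ?_⟩
    ext <;> simp [h']
  · rintro ⟨k, rfl⟩
    simp
  · dsimp at h hh
    have h' : biprod.inl ≫ h = 0 := by simpa using biprod.inr ≫= hh
    refine ⟨biprod.fst ≫ biprod.inr ≫ h, ?_⟩
    ext <;> simp [h']
  · rintro ⟨k, rfl⟩
    simp

/-- A Gorenstein object is a quotient of an object of `𝒞` by a Gorenstein object. -/
lemma IsGorenstein.exists_isSES {𝒞 : A → Prop} {G : A} (hG : IsGorenstein 𝒞 G) :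
    ∃ (G' C : A) (f : G' ⟶ C) (g : C ⟶ G), IsGorenstein 𝒞 G' ∧ 𝒞 C ∧ IsSES f g := by
  obtain ⟨X, d, hw, hX, hex, hl, hr, ⟨e⟩⟩ := hG
  let D : ∀ i j : ℤ, i + 1 = j → (X i ⟶ X j) := fun i j h => d i ≫ eqToHom (congrArg X h)
  have hD : ∀ i, D i (i + 1) rfl = d i := fun i => by simp [D]
  have hDw : ∀ i j k (hij : i + 1 = j) (hjk : j + 1 = k), D i j hij ≫ D j k hjk = 0 := by
    rintro i _ _ rfl rfl
    rw [hD, hD, hw]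
  have hDex : ∀ i j k (hij : i + 1 = j) (hjk : j + 1 = k),
      (ShortComplex.mk (D i j hij) (D j k hjk) (hDw i j k hij hjk)).Exact := by
    rintro i _ _ rfl rfl
    simpa only [hD] using hex i
  have hDl : ∀ i j k (hij : i + 1 = j) (hjk : j + 1 = k) ⦃C : A⦄, 𝒞 C →
      Function.Exact (fun h : C ⟶ X i => h ≫ D i j hij) (fun h : C ⟶ X j => h ≫ D j k hjk) := by
    rintro i _ _ rfl rfl
    simpa only [hD] using hl i
  have hDr : ∀ i j k (hij : i + 1 = j) (hjk : j + 1 = k) ⦃C : A⦄, 𝒞 C →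
      Function.Exact (fun h : X k ⟶ C => D j k hjk ≫ h) (fun h : X j ⟶ C => D i j hij ≫ h) := by
    rintro i _ _ rfl rfl
    simpa only [hD] using hr i
  have e' : G ≅ Limits.image (D 0 (0 + 1) rfl) := e ≪≫ Limits.image.eqToIso (hD 0).symm
  refine ⟨Limits.image (D (0 - 1) (0 + 1 - 1) (by lia)), X (0 + 1 - 1), _, _,
    ⟨fun n => X (n - 1), fun n => D (n - 1) (n + 1 - 1) (by lia),
      fun n => hDw _ _ _ (by lia) (by lia),
      fun n => hX _, fun n => hDex _ _ _ (by lia) (by lia),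
      fun n => hDl _ _ _ (by lia) (by lia), fun n => hDr _ _ _ (by lia) (by lia),
      ⟨Iso.refl _⟩⟩,
    hX _, isSES_image_of_exact _ _ _ (hDex (0 - 1) 0 (0 + 1) (by lia) rfl) e'⟩

section Ext

variable [HasExt.{w} A]

lemma IsSES.subsingleton_ext_mid {L M N : A} {f : L ⟶ M} {g : M ⟶ N} (h : IsSES f g) (G : A)
    (n : ℕ) (hL : Subsingleton (Abelian.Ext G L n)) (hN : Subsingleton (Abelian.Ext G N n)) :
    Subsingleton (Abelian.Ext G M n) := by
  obtain ⟨hw, hS⟩ := h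
  refine subsingleton_of_forall_eq 0 fun x => ?_
  obtain ⟨y, rfl⟩ := Ext.covariant_sequence_exact₂ G hS x (hN.elim _ _)
  rw [hL.elim y 0, Ext.zero_comp]

lemma IsSES.subsingleton_ext_right {L M N : A} {f : L ⟶ M} {g : M ⟶ N} (h : IsSES f g) (G : A)
    (n : ℕ) (hM : Subsingleton (Abelian.Ext G M n))
    (hL : Subsingleton (Abelian.Ext G L (n + 1))) :
    Subsingleton (Abelian.Ext G N n) := by
  obtain ⟨hw, hS⟩ := h
  refine subsingleton_of_forall_eq 0 fun x => ?_
  obtain ⟨y, rfl⟩ := Ext.covariant_sequence_exact₃ G hS x rfl (hL.elim _ _)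
  rw [hM.elim y 0, Ext.zero_comp]

/-- Dimension shifting in the first variable. -/
lemma IsSES.subsingleton_ext_succ {K P G : A} {f : K ⟶ P} {g : P ⟶ G} (h : IsSES f g) (L : A)
    (n : ℕ) (hK : Subsingleton (Abelian.Ext K L n))
    (hP : Subsingleton (Abelian.Ext P L (n + 1))) :
    Subsingleton (Abelian.Ext G L (n + 1)) := by
  obtain ⟨hw, hS⟩ := h
  refine subsingleton_of_forall_eq 0 fun x => ?_
  obtain ⟨y, rfl⟩ := Ext.contravariant_sequence_exact₃ hS L x (hP.elim _ _) (add_comm 1 n)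
  rw [hK.elim y 0, Ext.comp_zero]

/-- `Ext^2(G, L) = 0` for `G ∈ 𝒢(𝒞)` and `L ∈ 𝒢(𝒞)^{⊥1}`. -/
lemma RightPerp1.subsingleton_ext_two {𝒞 : A → Prop} (hadd : IsAdditiveClosed 𝒞)
    (hgen : ProjIsGeneratorFor 𝒞) {L : A} (hL : RightPerp1 𝒞 L) {G : A}
    (hG : IsGorenstein 𝒞 G) : Subsingleton (Abelian.Ext G L 2) := by
  obtain ⟨G', C, f, g, hG', hC, hfg⟩ := hG.exists_isSES
  obtain ⟨C', P, i, p, hP, hC', hip⟩ := hgen hC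
  exact hfg.subsingleton_ext_succ L 1 (hL hG')
    (hip.subsingleton_ext_succ L 1 (hL (isGorenstein_of_mem hadd hC'))
      (Ext.subsingleton_of_projective P L 1))

end Ext

/-- `𝒢(𝒞)^{⊥1}` is injectively coresolving in `A`. -/
theorem stmt_5 [HasExt.{w} A] (𝒞 : A → Prop) (hadd : IsAdditiveClosed 𝒞)
    (hso : SelfOrthogonal 𝒞) (hgen : ProjIsGeneratorFor 𝒞) :
    (∀ I : A, Injective I → RightPerp1 𝒞 I) ∧
    (∀ ⦃L M N : A⦄ (f : L ⟶ M) (g : M ⟶ N), IsSES f g →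
      RightPerp1 𝒞 L → RightPerp1 𝒞 N → RightPerp1 𝒞 M) ∧
    (∀ ⦃L M N : A⦄ (f : L ⟶ M) (g : M ⟶ N), IsSES f g →
      RightPerp1 𝒞 L → RightPerp1 𝒞 M → RightPerp1 𝒞 N) := by
  refine ⟨fun I _ G _ => Ext.subsingleton_of_injective G I 0,
    fun L M N f g h hL hN G hG => h.subsingleton_ext_mid G 1 (hL hG) (hN hG),
    fun L M N f g h hL hM G hG => h.subsingleton_ext_right G 1 (hM hG)
      (hL.subsingleton_ext_two hadd hgen hG)⟩
end

section
/- Let M∈𝒢(𝒞)^{⊥1} and let f: C→M be an epimorphism in 𝒜 with C∈𝒞. Then Ker f ∈ 𝒢(𝒞)^{⊥1} and f is a special 𝒢(𝒞)-precover of M. -/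
open CategoryTheory CategoryTheory.Limits CategoryTheory.Abelian ZeroObject

universe w t v u

variable {A : Type u} [Category.{v} A] [Abelian A]

section Splicing

variable {X Y Z W : A}

lemma shortExact_image_ι_factorThruImage {f : X ⟶ Y} {g : Y ⟶ Z} {hw : f ≫ g = 0}
    (h : (ShortComplex.mk f g hw).Exact) :
    IsSES (Limits.image.ι f) (factorThruImage g) := by
  have hw₁ : f ≫ factorThruImage g = 0 := by simp [← cancel_mono (Limits.image.ι g), hw]
  have hw₂ : Limits.image.ι f ≫ factorThruImage g = 0 := by
    simp [← cancel_epi (factorThruImage f), hw₁]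
  let φ : ShortComplex.mk f (factorThruImage g) hw₁ ⟶ ShortComplex.mk f g hw :=
    { τ₁ := 𝟙 _, τ₂ := 𝟙 _, τ₃ := Limits.image.ι g }
  let ψ : ShortComplex.mk f (factorThruImage g) hw₁ ⟶
      ShortComplex.mk (Limits.image.ι f) (factorThruImage g) hw₂ :=
    { τ₁ := factorThruImage f, τ₂ := 𝟙 _, τ₃ := 𝟙 _ }
  have : Epi φ.τ₁ := inferInstanceAs (Epi (𝟙 _))
  have : IsIso φ.τ₂ := inferInstanceAs (IsIso (𝟙 _))
  have : Mono φ.τ₃ := inferInstanceAs (Mono (Limits.image.ι g))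
  have : Epi ψ.τ₁ := inferInstanceAs (Epi (factorThruImage f))
  have : IsIso ψ.τ₂ := inferInstanceAs (IsIso (𝟙 _))
  have : Mono ψ.τ₃ := inferInstanceAs (Mono (𝟙 _))
  have hS := (ShortComplex.exact_iff_of_epi_of_isIso_of_mono ψ).1
    ((ShortComplex.exact_iff_of_epi_of_isIso_of_mono φ).2 h)
  exact ⟨hw₂, { exact := hS }⟩

lemma IsSES.of_iso_left {f : X ⟶ Y} {g : Y ⟶ Z} (h : IsSES f g) (e : W ≅ X) :
    IsSES (e.hom ≫ f) g := by
  obtain ⟨hw, hS⟩ := h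
  refine ⟨by simp [hw], ShortComplex.shortExact_of_iso ?_ hS⟩
  exact ShortComplex.isoMk e.symm (Iso.refl _) (Iso.refl _)

lemma IsSES.of_iso_right {f : X ⟶ Y} {g : Y ⟶ Z} (h : IsSES f g) (e : Z ≅ W) :
    IsSES f (g ≫ e.hom) := by
  obtain ⟨hw, hS⟩ := h
  refine ⟨by simp [reassoc_of% hw], ShortComplex.shortExact_of_iso ?_ hS⟩
  exact ShortComplex.isoMk (Iso.refl _) (Iso.refl _) e

end Splicing

section Gorenstein

variable {𝒞 : A → Prop}

lemma IsGorenstein.exists_isSES_right {G : A} (hG : IsGorenstein 𝒞 G) :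
    ∃ (X G' : A) (i : G ⟶ X) (p : X ⟶ G'), 𝒞 X ∧ IsGorenstein 𝒞 G' ∧ IsSES i p := by
  obtain ⟨X, d, hw, hX, hd, hl, hr, ⟨e⟩⟩ := hG
  exact ⟨X (0 + 1), Limits.image (d (0 + 1)), e.hom ≫ Limits.image.ι (d 0), factorThruImage _,
    hX _, ⟨fun n => X (n + 1), fun n => d (n + 1), fun n => hw (n + 1), fun n => hX (n + 1),
      fun n => hd (n + 1), fun n => hl (n + 1), fun n => hr (n + 1), ⟨Iso.refl _⟩⟩,
    (shortExact_image_ι_factorThruImage (hd 0)).of_iso_left e⟩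

lemma IsGorenstein.exists_isSES_left {G : A} (hG : IsGorenstein 𝒞 G) :
    ∃ (K X : A) (i : K ⟶ X) (p : X ⟶ G), 𝒞 X ∧ IsSES i p ∧
      ∀ ⦃C : A⦄, 𝒞 C → Function.Surjective (fun h : X ⟶ C => i ≫ h) := by
  obtain ⟨X, d, hw, hX, hd, hl, hr, ⟨e⟩⟩ := hG
  have he : ∀ m : ℤ, m = 0 → Nonempty (G ≅ Limits.image (d m)) := by
    rintro _ rfl
    exact ⟨e⟩
  obtain ⟨n, ⟨e⟩⟩ : ∃ n : ℤ, Nonempty (G ≅ Limits.image (d (n + 1 + 1))) := ⟨-2, he _ rfl⟩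
  refine ⟨_, _, Limits.image.ι (d (n + 1)), factorThruImage (d (n + 1 + 1)) ≫ e.inv, hX _,
    (shortExact_image_ι_factorThruImage (hd (n + 1))).of_iso_right e.symm, fun C hC u => ?_⟩
  have hu : d n ≫ factorThruImage (d (n + 1)) = 0 := by
    simp [← cancel_mono (Limits.image.ι (d (n + 1))), hw]
  obtain ⟨h, hh⟩ := (hr n hC (factorThruImage (d (n + 1)) ≫ u)).1 (by simp [reassoc_of% hu])
  refine ⟨h, ?_⟩
  simpa [← cancel_epi (factorThruImage (d (n + 1)))] using hh

/-- An object of `𝒞` is the image of the contractible complex `⋯ ⟶ C ⊞ C ⟶ C ⊞ C ⟶ ⋯` with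
differential `(a, b) ↦ (b, 0)`. -/
lemma IsAdditiveClosed.isGorenstein (hadd : IsAdditiveClosed 𝒞) {C : A} (hC : 𝒞 C) :
    IsGorenstein 𝒞 C := by
  let δ : C ⊞ C ⟶ C ⊞ C := biprod.snd ≫ biprod.inl
  let s : C ⊞ C ⟶ C ⊞ C := biprod.fst ≫ biprod.inr
  have hδ : δ ≫ δ = 0 := by simp [δ]
  have hs : δ ≫ s + s ≫ δ = 𝟙 _ := by
    simp only [δ, s, Category.assoc, biprod.inl_fst_assoc, biprod.inr_snd_assoc]
    rw [add_comm, biprod.total]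
  have hleft : ∀ D : A, Function.Exact (fun h : D ⟶ C ⊞ C => h ≫ δ)
      (fun h : D ⟶ C ⊞ C => h ≫ δ) := by
    refine fun D h => ⟨fun hh => ⟨h ≫ s, ?_⟩, ?_⟩
    · have := h ≫= hs
      simp only [Preadditive.comp_add, reassoc_of% hh, zero_comp, zero_add,
        Category.comp_id] at this
      simpa using this
    · rintro ⟨h, rfl⟩
      simp [hδ]
  have hright : ∀ D : A, Function.Exact (fun h : C ⊞ C ⟶ D => δ ≫ h)
      (fun h : C ⊞ C ⟶ D => δ ≫ h) := by
    refine fun D h => ⟨fun hh => ⟨s ≫ h, ?_⟩, ?_⟩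
    · have := hs =≫ h
      simpa [show δ ≫ h = 0 from hh] using this
    · rintro ⟨h, rfl⟩
      simp [reassoc_of% hδ]
  have e : C ≅ Limits.image δ := image.isoStrongEpiMono biprod.snd biprod.inl rfl
  refine ⟨fun _ => C ⊞ C, fun _ => δ, fun _ => hδ, fun _ => hadd.2.2 hC hC, fun _ => ?_,
    fun _ D _ => hleft D, fun _ D _ => hright D, ⟨e⟩⟩
  rw [ShortComplex.exact_iff_exact_up_to_refinements]
  intro D x hx
  obtain ⟨y, hy⟩ := (hleft D x).1 hx
  exact ⟨D, 𝟙 _, inferInstance, y, by simpa using hy.symm⟩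

end Gorenstein

section Ext

variable [HasExt.{w} A] {X Y Z : A} {i : X ⟶ Y} {p : Y ⟶ Z}

lemma IsSES.precomp_surjective (h : IsSES i p) (T : A) [Subsingleton (Abelian.Ext Z T 1)] :
    Function.Surjective (fun u : Y ⟶ T => i ≫ u) := by
  obtain ⟨hw, hS⟩ := h
  intro v
  obtain ⟨x, hx⟩ := Ext.contravariant_sequence_exact₁ hS T (Ext.mk₀ v) (add_zero 1)
    (Subsingleton.elim (α := Abelian.Ext Z T 1) _ _)
  obtain ⟨u, rfl⟩ := (Ext.mk₀_bijective _ _).2 x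
  exact ⟨u, (Ext.mk₀_bijective _ _).1 (by simpa using hx)⟩

lemma IsSES.subsingleton_ext_of_precomp_surjective (h : IsSES i p) (T : A)
    [Subsingleton (Abelian.Ext Y T 1)] (hT : Function.Surjective (fun u : Y ⟶ T => i ≫ u)) :
    Subsingleton (Abelian.Ext Z T 1) := by
  obtain ⟨hw, hS⟩ := h
  refine subsingleton_of_forall_eq 0 fun x => ?_
  obtain ⟨y, rfl⟩ := Ext.contravariant_sequence_exact₃ hS T x
    (Subsingleton.elim (α := Abelian.Ext Y T 1) _ _) (add_zero 1)
  obtain ⟨v, rfl⟩ := (Ext.mk₀_bijective _ _).2 y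
  obtain ⟨u, rfl⟩ := hT v
  simp only [← Ext.mk₀_comp_mk₀]
  exact hS.extClass_comp_assoc _

lemma IsSES.subsingleton_ext_of_postcomp_surjective (h : IsSES i p) (T : A)
    [Subsingleton (Abelian.Ext T Y 1)] (hT : Function.Surjective (fun u : T ⟶ Y => u ≫ p)) :
    Subsingleton (Abelian.Ext T X 1) := by
  obtain ⟨hw, hS⟩ := h
  refine subsingleton_of_forall_eq 0 fun x => ?_
  obtain ⟨y, rfl⟩ := Ext.covariant_sequence_exact₁ T hS x
    (Subsingleton.elim (α := Abelian.Ext T Y 1) _ _) (zero_add 1)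
  obtain ⟨v, rfl⟩ := (Ext.mk₀_bijective _ _).2 y
  obtain ⟨u, rfl⟩ := hT v
  simp only [← Ext.mk₀_comp_mk₀]
  rw [Ext.comp_assoc_of_second_deg_zero, hS.comp_extClass, Ext.comp_zero]

/-- The sequences `0 ⟶ C' ⟶ P ⟶ C ⟶ 0` provided by the generator hypothesis split, as
`Ext^1(C, C') = 0`. -/
lemma ProjIsGeneratorFor.projective {𝒞 : A → Prop} (hgen : ProjIsGeneratorFor 𝒞)
    (hso : SelfOrthogonal 𝒞) {C : A} (hC : 𝒞 C) : Projective C := by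
  obtain ⟨C', P, i, p, hP, hC', h⟩ := hgen hC
  have := hso hC hC' 1 le_rfl
  obtain ⟨r, hr⟩ := h.precomp_surjective C' (𝟙 C')
  obtain ⟨hw, hS⟩ := h
  let sp := ShortComplex.Splitting.ofExactOfRetraction _ hS.exact r hr hS.epi_g
  exact (Retract.mk sp.s p sp.s_g).projective

end Ext

/-- if `M ∈ 𝒢(𝒞)^{⊥1}` and `f : C ⟶ M` is an epimorphism with `C ∈ 𝒞`,
then `Ker f ∈ 𝒢(𝒞)^{⊥1}` and `f` is a special `𝒢(𝒞)`-precover of `M`. -/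
theorem stmt_8 [HasExt.{w} A] (𝒞 : A → Prop) (hadd : IsAdditiveClosed 𝒞)
    (hso : SelfOrthogonal 𝒞) (hgen : ProjIsGeneratorFor 𝒞)
    {C M : A} (hM : RightPerp1 𝒞 M) (hC : 𝒞 C) (f : C ⟶ M) (hf : Epi f) :
    RightPerp1 𝒞 (kernel f) ∧ IsSpecialPrecover 𝒞 f := by
  have hproj {X : A} (hX : 𝒞 X) : Projective X := hgen.projective hso hX
  have hlift ⦃G : A⦄ (hG : IsGorenstein 𝒞 G) : Function.Surjective (fun h : G ⟶ C => h ≫ f) := by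
    intro g
    obtain ⟨X, G', i, p, hX, hG', h⟩ := hG.exists_isSES_right
    have := hM hG'
    have := hproj hX
    obtain ⟨u, hu⟩ := h.precomp_surjective M g
    exact ⟨i ≫ Projective.factorThru u f, by simpa using hu⟩
  have hker : RightPerp1 𝒞 (kernel f) := by
    intro G hG
    obtain ⟨K, X, i, p, hX, h, hext⟩ := hG.exists_isSES_left
    have := hproj hX
    have := Ext.subsingleton_of_projective X C 0
    have := h.subsingleton_ext_of_precomp_surjective C (hext hC)
    have hf : IsSES (kernel.ι f) f :=
      ⟨kernel.condition f, { exact := ShortComplex.exact_kernel f }⟩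
    exact hf.subsingleton_ext_of_postcomp_surjective G (hlift hG)
  exact ⟨hker, hadd.isGorenstein hC, hf, hker, hlift⟩
end
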